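/- Let q > 1 be a rational number, g ≥ 1, and let α₁, …, α_g be complex numbers of modulus √q with arguments θ₁, …, θ_g ∈ (0, π). Suppose none of the quotients α_i/α_j (i ≠ j) and none of \bar{α_i}/α_j is a root of unity. Let m₀, m_π ≥ 0 be integers and m_j > 0 integers, and set Δ(n) = (m₀ + 1/2) + (m_π + 1/2)(−1)^n + ∑_{j=1}^g 2 m_j cos(n θ_j). Then {n ∈ ℕ : Δ(n) = 0} is finite. -/

import Mathlib

section

open Polynomial

theorem eval_mem_of_coeff_mem_of_roots {O : Type*} [CommRing O] [IsDomain O] (I : Ideal O)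
    (P : O[X]) (S : Finset O) (hS : ∀ x ∈ S, P.eval x = 0)
    (hP : ∀ k, S.card ≤ k → P.coeff k ∈ I) (t : O) : P.eval t ∈ I := by
  have hdvd : ∏ x ∈ S, (X - C x) ∣ P := by
    rcases eq_or_ne P 0 with rfl | h0
    · exact dvd_zero _
    · have h := (Multiset.prod_X_sub_C_dvd_iff_le_roots h0 S.val).2
        ((Multiset.le_iff_subset S.nodup).2 fun x hx => (mem_roots h0).2 (hS x hx))
      exact h
  have hmonic : (∏ x ∈ S, (X - C x)).Monic := monic_prod_of_monic _ _ fun x _ => monic_X_sub_C x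
  have hzero : P.map (Ideal.Quotient.mk I) = 0 := by
    rcases subsingleton_or_nontrivial (O ⧸ I) with _ | _
    · exact Subsingleton.elim _ _
    by_contra hne
    have hlt : (P.map (Ideal.Quotient.mk I)).degree < (S.card : WithBot ℕ) := by
      rw [degree_lt_iff_coeff_zero]
      intro k hk
      rw [coeff_map, Ideal.Quotient.eq_zero_iff_mem]
      exact hP k hk
    refine (hmonic.map (Ideal.Quotient.mk I)).not_dvd_of_degree_lt hne ?_
      (Polynomial.map_dvd (Ideal.Quotient.mk I) hdvd)
    rw [hmonic.degree_map, degree_prod]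
    simpa using hlt
  rw [← Ideal.Quotient.eq_zero_iff_mem, ← eval_map_apply, hzero, eval_zero]

theorem two_mul_padicValNat_factorial_le {p : ℕ} (hp : p.Prime) (hp3 : 3 ≤ p) (k : ℕ) :
    2 * padicValNat p k.factorial ≤ k := by
  have := Fact.mk hp
  have h := sub_one_mul_padicValNat_factorial (p := p) k
  have h2 : 2 * padicValNat p k.factorial ≤ (p - 1) * padicValNat p k.factorial :=
    Nat.mul_le_mul_right _ (by omega)
  omega

theorem eq_zero_of_infinite_zeros {O : Type*} [CommRing O] [IsDomain O] [IsNoetherianRing O]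
    [CharZero O] {p : ℕ} (hp : p.Prime) (hp3 : 3 ≤ p) (hpu : ¬ IsUnit (p : O)) (b : ℕ → O)
    (hinf : {n : ℕ | ∑ k ∈ Finset.range (n + 1), (n.choose k : O) * p ^ k * b k = 0}.Infinite)
    (t : ℕ) : ∑ k ∈ Finset.range (t + 1), (t.choose k : O) * p ^ k * b k = 0 := by
  have := Fact.mk hp
  have hbot := Ideal.iInf_pow_eq_bot_of_isDomain (Ideal.span {(p : O)})
    (by rwa [Ne, Ideal.span_singleton_eq_top])
  rw [← Ideal.mem_bot, ← hbot, Ideal.mem_iInf]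
  intro E
  obtain ⟨S, hS, hcard⟩ := hinf.exists_subset_card_eq (2 * E)
  set N := max t (S.sup id) with hN
  set v := padicValNat p N.factorial with hv
  obtain ⟨w, hw⟩ : p ^ v ∣ N.factorial := pow_padicValNat_dvd
  have hwp : p.Coprime w := by
    rw [hp.coprime_iff_not_dvd]
    intro hdvd
    have : p ^ (v + 1) ∣ N.factorial := by
      rw [hw, pow_succ]; exact mul_dvd_mul_left _ hdvd
    exact pow_succ_padicValNat_not_dvd N.factorial_ne_zero this
  set P : O[X] := ∑ k ∈ Finset.range (N + 1),
    C (((N.factorial / k.factorial : ℕ) : O) * p ^ k * b k) * descPochhammer O k with hPdef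
  have heval : ∀ n ≤ N, P.eval (n : O) =
      N.factorial * ∑ k ∈ Finset.range (n + 1), (n.choose k : O) * p ^ k * b k := by
    intro n hn
    have hext : ∑ k ∈ Finset.range (n + 1), (n.choose k : O) * p ^ k * b k =
        ∑ k ∈ Finset.range (N + 1), (n.choose k : O) * p ^ k * b k := by
      apply Finset.sum_subset (Finset.range_subset_range.2 (by omega))
      intro k _ hk
      rw [Nat.choose_eq_zero_of_lt (by simpa using hk)]
      simp
    rw [hext, hPdef, eval_finsetSum, Finset.mul_sum]
    refine Finset.sum_congr rfl fun k hk => ?_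
    rw [eval_mul, eval_C, descPochhammer_eval_eq_descFactorial, Nat.descFactorial_eq_factorial_mul_choose]
    have hk' : k ≤ N := by simpa [Nat.lt_succ_iff] using hk
    have h1 : ((N.factorial / k.factorial : ℕ) : O) * (k.factorial : O) = N.factorial := by
      exact_mod_cast Nat.div_mul_cancel (Nat.factorial_dvd_factorial hk')
    rw [← h1]
    push_cast
    ring
  have hmem : P.eval (t : O) ∈ Ideal.span {((p ^ (v + E) : ℕ) : O)} := by
    refine eval_mem_of_coeff_mem_of_roots _ P (S.map Nat.castEmbedding) ?_ ?_ _
    · intro x hx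
      obtain ⟨n, hn, rfl⟩ := Finset.mem_map.1 hx
      have hle : n ≤ N := le_max_of_le_right (Finset.le_sup (f := id) hn)
      have := hS hn
      simp only [Set.mem_ofPred_eq] at this
      rw [Nat.castEmbedding_apply, heval n hle, this, mul_zero]
    · intro j hj
      rw [Finset.card_map, hcard] at hj
      rw [hPdef, finsetSum_coeff]
      refine Ideal.sum_mem _ fun k hk => ?_
      rw [coeff_C_mul]
      have hk' : k ≤ N := by simpa [Nat.lt_succ_iff] using hk
      rcases lt_or_ge k j with hkj | hkj
      · rw [coeff_eq_zero_of_natDegree_lt (by rwa [descPochhammer_natDegree]), mul_zero]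
        exact Ideal.zero_mem _
      · refine Ideal.mul_mem_right _ _ (Ideal.mul_mem_right _ _ ?_)
        rw [Ideal.mem_span_singleton]
        have key : p ^ (v + E) ∣ N.factorial / k.factorial * p ^ k := by
          have h0 : N.factorial / k.factorial ≠ 0 :=
            (Nat.div_pos (Nat.factorial_le hk') k.factorial_pos).ne'
          rw [padicValNat_dvd_iff_le (mul_ne_zero h0 (pow_ne_zero _ hp.ne_zero)),
            padicValNat.mul h0 (pow_ne_zero _ hp.ne_zero), padicValNat.prime_pow]
          have h1 : padicValNat p (N.factorial / k.factorial) + padicValNat p k.factorial = v := by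
            rw [← padicValNat.mul h0 k.factorial_ne_zero,
              Nat.div_mul_cancel (Nat.factorial_dvd_factorial hk')]
          have h2 := two_mul_padicValNat_factorial_le hp hp3 k
          omega
        exact_mod_cast Nat.cast_dvd_cast (α := O) key
  rw [heval t (le_max_left _ _), Ideal.mem_span_singleton, hw] at hmem
  push_cast at hmem
  rw [pow_add, mul_assoc, mul_dvd_mul_iff_left (pow_ne_zero _ (by exact_mod_cast hp.ne_zero))]
    at hmem
  rw [Ideal.span_singleton_pow, Ideal.mem_span_singleton]
  have hcop : IsCoprime ((p : O) ^ E) (w : O) :=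
    hwp.cast.pow_left
  exact hcop.dvd_of_dvd_mul_left hmem

theorem progression_eq_zero {O : Type*} [CommRing O] [IsDomain O] [IsNoetherianRing O]
    [CharZero O] {p : ℕ} (hp : p.Prime) (hp3 : 3 ≤ p) (hpu : ¬ IsUnit (p : O))
    {ι : Type*} [Fintype ι] (c ρ : ι → O) (a d : ℕ) (hd : ∀ i, (p : O) ∣ ρ i ^ d - 1)
    (hinf : {n : ℕ | ∑ i, c i * ρ i ^ (a + d * n) = 0}.Infinite) (n : ℕ) :
    ∑ i, c i * ρ i ^ (a + d * n) = 0 := by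
  choose y hy using hd
  have key : ∀ n : ℕ, ∑ i, c i * ρ i ^ (a + d * n) =
      ∑ k ∈ Finset.range (n + 1), (n.choose k : O) * p ^ k * ∑ i, c i * ρ i ^ a * y i ^ k := by
    intro n
    simp_rw [Finset.mul_sum]
    rw [Finset.sum_comm]
    refine Finset.sum_congr rfl fun i _ => ?_
    rw [pow_add, pow_mul, sub_eq_iff_eq_add.1 (hy i), add_pow, ← mul_assoc, Finset.mul_sum]
    refine Finset.sum_congr rfl fun k _ => ?_
    rw [mul_pow, one_pow]
    ring
  simp_rw [key] at hinf ⊢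
  exact eq_zero_of_infinite_zeros hp hp3 hpu _ hinf n

theorem coeff_eq_zero_of_power_sums_eq_zero {F : Type*} [Field F] {ι : Type*} [Fintype ι]
    [DecidableEq ι] (c x : ι → F) (i₀ : ι) (hx : ∀ i, i ≠ i₀ → x i ≠ x i₀)
    (h : ∀ n : ℕ, ∑ i, c i * x i ^ n = 0) : c i₀ = 0 := by
  have hpoly : ∀ P : F[X], ∑ i, c i * P.eval (x i) = 0 := by
    intro P
    simp_rw [eval_eq_sum_range, Finset.mul_sum]
    rw [Finset.sum_comm]
    refine Finset.sum_eq_zero fun n _ => ?_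
    have := congrArg (P.coeff n * ·) (h n)
    simp only [mul_zero, Finset.mul_sum] at this
    rw [← this]
    exact Finset.sum_congr rfl fun i _ => by ring
  have h1 := hpoly (∏ i ∈ Finset.univ.erase i₀, (X - C (x i)))
  rw [Finset.sum_eq_single i₀] at h1
  · refine (mul_eq_zero.1 h1).resolve_right ?_
    rw [eval_prod, ← ne_eq, Finset.prod_ne_zero_iff]
    intro i hi
    simpa [sub_eq_zero] using (hx i (Finset.ne_of_mem_erase hi)).symm
  · intro i _ hi
    rw [eval_prod, Finset.prod_eq_zero (Finset.mem_erase.2 ⟨hi, Finset.mem_univ i⟩), mul_zero]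
    simp
  · simp

theorem exists_infinite_progression {Z : Set ℕ} (hZ : Z.Infinite) {d : ℕ} (hd : 0 < d) :
    ∃ a, {n : ℕ | a + d * n ∈ Z}.Infinite := by
  by_contra! hcon
  refine hZ (((Finset.range d).finite_toSet.biUnion
    fun a _ => (hcon a).image fun n => a + d * n).subset fun n hn => ?_)
  simp only [Set.mem_iUnion]
  refine ⟨n % d, by simpa using Nat.mod_lt n hd, n / d, ?_, Nat.mod_add_div n d⟩
  simpa only [Set.mem_ofPred_eq, Nat.mod_add_div] using hn

open NumberField in
theorem NumberField.finite_zeros_of_power_sum {F : Type*} [Field F] [NumberField F]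
    {ι : Type*} [Fintype ι] [DecidableEq ι] (c : ι → ℤ) (β : ι → F) (hβ : ∀ i, β i ≠ 0)
    (i₀ : ι) (hc : c i₀ ≠ 0) (hroot : ∀ i, i ≠ i₀ → ∀ n : ℕ, 0 < n → (β i / β i₀) ^ n ≠ 1) :
    {n : ℕ | ∑ i, (c i : F) * β i ^ n = 0}.Finite := by
  classical
  by_contra hinf
  obtain ⟨y, hy0, hy⟩ := exists_integral_multiples ℤ ℚ (L := F) (Finset.univ.image β ∪ Finset.univ.image fun i => (β i)⁻¹)
  have hρ : ∀ i, ∃ r : 𝓞 F, (r : F) = y * β i := fun i =>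
    ⟨⟨y * β i, by simpa [mem_integralClosure_iff] using hy (β i) (by simp)⟩, rfl⟩
  have hσ : ∀ i, ∃ r : 𝓞 F, (r : F) = y * (β i)⁻¹ := fun i =>
    ⟨⟨y * (β i)⁻¹, by simpa [mem_integralClosure_iff] using hy (β i)⁻¹ (by simp)⟩, rfl⟩
  choose ρ hρ using hρ
  choose σ hσ using hσ
  have hyF : (y : F) ≠ 0 := by exact_mod_cast hy0
  obtain ⟨p, hple, hp⟩ := Nat.exists_infinite_primes (y.natAbs + 3)
  have hcop : IsCoprime (p : 𝓞 F) (y : 𝓞 F) := by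
    have h : IsCoprime (p : ℤ) y := by
      rw [Int.isCoprime_iff_gcd_eq_one, Int.gcd_eq_natAbs, Int.natAbs_natCast]
      refine (hp.coprime_iff_not_dvd).2 fun hdvd => ?_
      have := Nat.le_of_dvd (Int.natAbs_pos.2 hy0) hdvd
      omega
    simpa using h.map (Int.castRingHom (𝓞 F))
  have hpu : ¬ IsUnit (p : 𝓞 F) := by
    intro hu
    have h : IsUnit (algebraMap ℤ (𝓞 F) p) := by simpa using hu
    have h2 := (isUnit_map_iff (algebraMap ℤ (𝓞 F)) (p : ℤ)).1 h
    exact (Nat.prime_iff_prime_int.1 hp).not_isUnit h2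
  have hcopρ : ∀ i, IsCoprime (p : 𝓞 F) (ρ i) := by
    intro i
    have : (y : 𝓞 F) ^ 2 = ρ i * σ i := by
      apply RingOfIntegers.coe_injective
      have := hβ i
      simp only [map_mul, map_pow, hρ, hσ, map_intCast]
      field_simp
    exact (this ▸ hcop.pow_right).of_mul_right_left
  have hfin : Finite (𝓞 F ⧸ Ideal.span {(p : 𝓞 F)}) :=
    Ideal.finiteQuotientOfFreeOfNeBot _ (by simpa using hp.ne_zero)
  set d := Nat.card (𝓞 F ⧸ Ideal.span {(p : 𝓞 F)})ˣ with hd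
  have hd0 : 0 < d := Nat.card_pos
  have hdvd : ∀ i, (p : 𝓞 F) ∣ ρ i ^ d - 1 := by
    intro i
    obtain ⟨u, v, huv⟩ := hcopρ i
    rw [← Ideal.mem_span_singleton, ← Ideal.Quotient.eq_zero_iff_mem, map_sub, map_pow, map_one,
      sub_eq_zero]
    have hunit : IsUnit (Ideal.Quotient.mk (Ideal.span {(p : 𝓞 F)}) (ρ i)) := by
      refine IsUnit.of_mul_eq_one (Ideal.Quotient.mk _ v) ?_
      rw [← map_mul, ← map_one (Ideal.Quotient.mk _), Ideal.Quotient.eq,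
        Ideal.mem_span_singleton]
      exact ⟨-u, by linear_combination huv⟩
    obtain ⟨w, hw⟩ := hunit
    rw [← hw, ← Units.val_pow_eq_pow_val, hd, pow_card_eq_one', Units.val_one]
  obtain ⟨a, ha⟩ := exists_infinite_progression hinf hd0
  have hcoe : ∀ n : ℕ, ((∑ i, (c i : 𝓞 F) * ρ i ^ n : 𝓞 F) : F) =
      y ^ n * ∑ i, (c i : F) * β i ^ n := by
    intro n
    simp only [map_sum, map_mul, map_pow, hρ, map_intCast, Finset.mul_sum]
    exact Finset.sum_congr rfl fun i _ => by ring
  have hzero := progression_eq_zero hp (by omega) hpu (fun i => (c i : 𝓞 F)) ρ a d hdvd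
    (ha.mono fun n hn => by
      simp only [Set.mem_ofPred_eq] at hn ⊢
      apply RingOfIntegers.coe_injective
      refine (hcoe _).trans ?_
      rw [hn, mul_zero, map_zero])
  refine mul_ne_zero (a := (c i₀ : F)) (b := β i₀ ^ a) (by exact_mod_cast hc)
    (pow_ne_zero _ (hβ i₀)) ?_
  refine coeff_eq_zero_of_power_sums_eq_zero (fun i => (c i : F) * β i ^ a)
    (fun i => β i ^ d) i₀ (fun i hi heq => ?_) fun n => ?_
  · refine hroot i hi d hd0 ?_
    rw [div_pow, div_eq_one_iff_eq (pow_ne_zero _ (hβ i₀))]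
    exact heq
  · have h1 := hcoe (a + d * n)
    rw [hzero n, show ((0 : 𝓞 F) : F) = 0 from map_zero (algebraMap (𝓞 F) F), eq_comm,
      mul_eq_zero] at h1
    rw [← h1.resolve_left (pow_ne_zero (a + d * n) hyF)]
    exact Finset.sum_congr rfl fun i _ => by rw [pow_add, pow_mul, mul_assoc]

theorem pow_factorial_eq_one_of_finrank_le {F : Type*} [Field F] [CharZero F]
    [FiniteDimensional ℚ F] {D : ℕ} (hD : Module.finrank ℚ F ≤ D) {ζ : F} {n : ℕ} (hn : 0 < n)
    (hζ : ζ ^ n = 1) : ζ ^ (2 * D).factorial = 1 := by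
  have hprim := IsPrimitiveRoot.orderOf ζ
  have hpos : 0 < orderOf ζ := orderOf_pos_iff.2 (isOfFinOrder_iff_pow_eq_one.2 ⟨n, hn, hζ⟩)
  have htot : (orderOf ζ).totient ≤ D := by
    rw [← natDegree_cyclotomic (orderOf ζ) ℚ, cyclotomic_eq_minpoly_rat hprim hpos]
    exact (minpoly.natDegree_le ζ).trans hD
  refine orderOf_dvd_iff_pow_eq_one.1 ((Nat.dvd_iff_prime_pow_dvd_dvd _ _).2 fun p k hp hpk => ?_)
  refine Nat.dvd_factorial (pow_pos hp.pos _) ?_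
  rcases k with _ | k
  · have := Nat.totient_pos.2 hpos
    rw [pow_zero]
    omega
  · have h1 := Nat.le_of_dvd (Nat.totient_pos.2 hpos) (Nat.totient_dvd_of_dvd hpk)
    rw [Nat.totient_prime_pow_succ hp] at h1
    have h2 : p ^ (k + 1) ≤ 2 * (p ^ k * (p - 1)) := by
      rw [pow_succ, mul_left_comm]
      exact Nat.mul_le_mul_left _ (by have := hp.two_le; omega)
    omega

theorem finiteDimensional_and_finrank_le_of_rat_combinations {F : Type*} [Field F] [CharZero F]
    {D : ℕ} (e : Fin D → F) (he : ∀ x : F, ∃ f : Fin D → ℚ, ∑ i, (f i : F) * e i = x) :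
    FiniteDimensional ℚ F ∧ Module.finrank ℚ F ≤ D := by
  have hspan : Submodule.span ℚ (Set.range e) = ⊤ := by
    rw [eq_top_iff]
    intro x _
    obtain ⟨f, rfl⟩ := he x
    exact (Submodule.mem_span_range_iff_exists_fun _).2
      ⟨f, Finset.sum_congr rfl fun i _ => Rat.smul_def _ _⟩
  refine ⟨⟨hspan ▸ Submodule.fg_span (Set.finite_range _)⟩, ?_⟩
  have h := finrank_range_le_card (R := ℚ) e
  rwa [Set.finrank, hspan, finrank_top, Fintype.card_fin] at h

universe u in
theorem exists_bounded_specialization (A : Type u) [CommRing A] [IsDomain A] [Algebra ℚ A]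
    [Algebra.FiniteType ℚ A] :
    ∃ D : ℕ, ∀ s : A, s ≠ 0 → ∃ (F : Type u) (_ : Field F) (_ : CharZero F)
      (_ : FiniteDimensional ℚ F) (φ : A →+* F), Module.finrank ℚ F ≤ D ∧ φ s ≠ 0 := by
  obtain ⟨r, g, hginj, hgfin⟩ := exists_finite_inj_algHom_of_fg ℚ A
  let : Algebra (MvPolynomial (Fin r) ℚ) A := g.toRingHom.toAlgebra
  have hfinite : Module.Finite (MvPolynomial (Fin r) ℚ) A := hgfin
  have hinj : Function.Injective (algebraMap (MvPolynomial (Fin r) ℚ) A) := hginj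
  obtain ⟨D, e, he⟩ := Module.Finite.exists_fin (R := MvPolynomial (Fin r) ℚ) (M := A)
  refine ⟨D, fun s hs => ?_⟩
  obtain ⟨c, hc0, hcs⟩ := (Algebra.IsAlgebraic.isAlgebraic (R := MvPolynomial (Fin r) ℚ)
    s).exists_nonzero_dvd (mem_nonZeroDivisors_of_ne_zero hs)
  obtain ⟨a, ha⟩ : ∃ a : Fin r → ℚ, MvPolynomial.eval a c ≠ 0 := by
    by_contra! hcon
    exact hc0 (MvPolynomial.funext fun a => by simpa using hcon a)
  have hmax : (RingHom.ker (MvPolynomial.eval a)).IsMaximal :=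
    RingHom.ker_isMaximal_of_surjective _ fun q => ⟨MvPolynomial.C q, by simp⟩
  obtain ⟨Q, hQmax, hQ⟩ := Ideal.exists_ideal_over_maximal_of_isIntegral (S := A)
    (RingHom.ker (MvPolynomial.eval a)) (by
      rw [(RingHom.injective_iff_ker_eq_bot _).1 hinj]; exact bot_le)
  let := Ideal.Quotient.field Q
  let φ : A →+* A ⧸ Q := Ideal.Quotient.mk Q
  have hchar : CharZero (A ⧸ Q) :=
    charZero_of_injective_ringHom (φ.comp (algebraMap ℚ A)).injective
  have hφ : ∀ f : MvPolynomial (Fin r) ℚ,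
      φ (algebraMap _ A f) = ((MvPolynomial.eval a f : ℚ) : A ⧸ Q) := by
    intro f
    have h1 : f - MvPolynomial.C (MvPolynomial.eval a f) ∈ Q.comap (algebraMap _ A) := by
      rw [hQ, RingHom.mem_ker]
      simp
    rw [Ideal.mem_comap, ← Ideal.Quotient.eq_zero_iff_mem, map_sub, map_sub, sub_eq_zero] at h1
    exact h1.trans (eq_ratCast ((φ.comp (algebraMap (MvPolynomial (Fin r) ℚ) A)).comp
      MvPolynomial.C) _)
  have hcomb : ∀ x : A ⧸ Q, ∃ f : Fin D → ℚ, ∑ i, (f i : A ⧸ Q) * φ (e i) = x := by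
    intro x
    obtain ⟨x, rfl⟩ := Ideal.Quotient.mk_surjective x
    obtain ⟨f, rfl⟩ := (Submodule.mem_span_range_iff_exists_fun _).1
      (he ▸ Submodule.mem_top : x ∈ Submodule.span _ (Set.range e))
    refine ⟨fun i => MvPolynomial.eval a (f i), ?_⟩
    change _ = φ _
    rw [map_sum]
    refine Finset.sum_congr rfl fun i _ => ?_
    rw [Algebra.smul_def (f i), map_mul, hφ]
  obtain ⟨hfd, hrank⟩ := finiteDimensional_and_finrank_le_of_rat_combinations
    (fun i => φ (e i)) hcomb
  refine ⟨A ⧸ Q, inferInstance, hchar, hfd, φ, hrank, fun h0 => ha ?_⟩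
  · obtain ⟨t, ht⟩ := hcs
    have h1 := hφ c
    rw [ht, map_mul, h0, zero_mul] at h1
    exact_mod_cast h1.symm

/-- A special case of the Skolem–Mahler–Lech theorem. -/
theorem finite_zeros_of_power_sum {K : Type*} [Field K] [CharZero K]
    {ι : Type*} [Fintype ι] (c : ι → ℤ) (β : ι → K) (hβ : ∀ i, β i ≠ 0)
    (i₀ : ι) (hc : c i₀ ≠ 0) (hroot : ∀ i, i ≠ i₀ → ∀ n : ℕ, 0 < n → (β i / β i₀) ^ n ≠ 1) :
    {n : ℕ | ∑ i, (c i : K) * β i ^ n = 0}.Finite := by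
  classical
  let A := Algebra.adjoin ℚ (Set.range β ∪ Set.range fun i => (β i)⁻¹)
  have hA : Algebra.FiniteType ℚ A := (Subalgebra.fg_iff_finiteType _).1
    (Subalgebra.fg_def.2 ⟨_, (Set.finite_range _).union (Set.finite_range _), rfl⟩)
  let b : ι → A := fun i => ⟨β i, Algebra.subset_adjoin (Or.inl ⟨i, rfl⟩)⟩
  let b' : ι → A := fun i => ⟨(β i)⁻¹, Algebra.subset_adjoin (Or.inr ⟨i, rfl⟩)⟩
  have hbb' : ∀ i, b i * b' i = 1 := fun i => Subtype.ext (mul_inv_cancel₀ (hβ i))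
  obtain ⟨D, hD⟩ := exists_bounded_specialization A
  have hs : ∏ i ∈ Finset.univ.erase i₀, ((b i * b' i₀) ^ (2 * D).factorial - 1) ≠ 0 := by
    rw [Finset.prod_ne_zero_iff]
    intro i hi h0
    refine hroot i (Finset.ne_of_mem_erase hi) _ (Nat.factorial_pos (2 * D)) ?_
    rw [div_eq_mul_inv]
    exact congrArg Subtype.val (sub_eq_zero.1 h0)
  obtain ⟨F, _, _, _, φ, hfin, hφ⟩ := hD _ hs
  have : NumberField F := ⟨⟩
  have hφbb' : ∀ i, φ (b i) * φ (b' i) = 1 := fun i => by rw [← map_mul, hbb', map_one]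
  refine (NumberField.finite_zeros_of_power_sum c (fun i => φ (b i))
    (fun i => left_ne_zero_of_mul_eq_one (hφbb' i)) i₀ hc fun i hi n hn h => ?_).subset ?_
  · rw [map_prod, Finset.prod_ne_zero_iff] at hφ
    refine hφ i (Finset.mem_erase.2 ⟨hi, Finset.mem_univ i⟩) ?_
    rw [map_sub, map_pow, map_mul, map_one, sub_eq_zero, eq_inv_of_mul_eq_one_right (hφbb' i₀),
      ← div_eq_mul_inv]
    exact pow_factorial_eq_one_of_finrank_le hfin hn h
  · intro n hn
    have h0 : ∑ i, (c i : A) * b i ^ n = 0 := Subtype.ext (by simpa [b] using hn)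
    simpa using congrArg φ h0

end

open Real Complex

/-- If the character is non-degenerate (no quotient of the Frobenius
eigenvalues, nor of a conjugate with an eigenvalue, is a root of unity), then
the zero set of the bias term `Δ` is finite. -/
theorem zero_set_of_Delta_finite {g : ℕ} (hg : 1 ≤ g) (q : ℚ) (hq : 1 < q)
    (α : Fin g → ℂ) (θ : Fin g → ℝ) (hθ : ∀ j, θ j ∈ Set.Ioo 0 π)
    (hα : ∀ j, α j = (Real.sqrt (q : ℝ) : ℂ) * Complex.exp ((θ j : ℂ) * Complex.I))
    (hnd₁ : ∀ i j, i ≠ j → ¬ ∃ n : ℕ, 0 < n ∧ (α i / α j) ^ n = 1)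
    (hnd₂ : ∀ i j, ¬ ∃ n : ℕ, 0 < n ∧ ((starRingEnd ℂ) (α i) / α j) ^ n = 1)
    (m₀ mπ : ℕ) (m : Fin g → ℕ) (hm : ∀ j, 0 < m j) (Δ : ℕ → ℝ)
    (hΔ : ∀ n : ℕ, Δ n = ((m₀ : ℝ) + 1 / 2) + ((mπ : ℝ) + 1 / 2) * (-1) ^ n +
      ∑ j, 2 * (m j : ℝ) * Real.cos (n * θ j)) :
    {n : ℕ | Δ n = 0}.Finite := by
  have hsqrt : (Real.sqrt (q : ℝ) : ℂ) ≠ 0 := by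
    have hq' : (0 : ℝ) < q := by exact_mod_cast zero_lt_one.trans hq
    exact_mod_cast (Real.sqrt_pos.2 hq').ne'
  let z : Fin g → ℂ := fun j => Complex.exp ((θ j : ℂ) * Complex.I)
  have hz : ∀ j, z j ≠ 0 := fun j => Complex.exp_ne_zero _
  have hconj : ∀ j, (starRingEnd ℂ) (z j) = (z j)⁻¹ := by
    intro j
    rw [← Complex.exp_conj, ← Complex.exp_neg]
    simp
  have hquot : ∀ i j, α i / α j = z i / z j := by
    intro i j
    rw [hα, hα, mul_div_mul_left _ _ hsqrt]
  have hquot' : ∀ i j, (starRingEnd ℂ) (α i) / α j = (z i)⁻¹ / z j := by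
    intro i j
    rw [hα, hα, map_mul, Complex.conj_ofReal, mul_div_mul_left _ _ hsqrt, ← hconj]
  simp only [hquot, hquot'] at hnd₁ hnd₂
  let j₀ : Fin g := ⟨0, hg⟩
  let c : (Unit ⊕ Unit) ⊕ (Fin g ⊕ Fin g) → ℤ := Sum.elim
    (Sum.elim (fun _ => 2 * m₀ + 1) fun _ => 2 * mπ + 1)
    (Sum.elim (fun j => 2 * m j) fun j => 2 * m j)
  let β : (Unit ⊕ Unit) ⊕ (Fin g ⊕ Fin g) → ℂ := Sum.elim
    (Sum.elim (fun _ => 1) fun _ => -1) (Sum.elim z fun j => (z j)⁻¹)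
  have hβ : ∀ i, β i ≠ 0 := by
    rintro ((_ | _) | (j | j)) <;> simp [β, hz]
  have hnotroot : ∀ ε : ℂ, ε ^ 2 = 1 → ∀ n : ℕ, 0 < n → (ε / z j₀) ^ n ≠ 1 := by
    intro ε hε n hn h
    refine hnd₂ j₀ j₀ ⟨n, hn, ?_⟩
    have h1 : (z j₀)⁻¹ / z j₀ = (ε / z j₀) ^ 2 := by
      rw [div_pow, hε]
      field_simp
    rw [h1, ← pow_mul, mul_comm, pow_mul, h, one_pow]
  refine (finite_zeros_of_power_sum c β hβ (Sum.inr (Sum.inl j₀)) ?_ ?_).subset ?_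
  · simpa [c] using (hm j₀).ne'
  · rintro ((_ | _) | (j | j)) hj n hn
    · exact hnotroot 1 (one_pow 2) n hn
    · exact hnotroot (-1) (by norm_num) n hn
    · exact fun h => hnd₁ j j₀ (fun heq => hj (by rw [heq])) ⟨n, hn, h⟩
    · exact fun h => hnd₂ j j₀ ⟨n, hn, h⟩
  · intro n hn
    have hcos : ∀ j, z j ^ n + (z j)⁻¹ ^ n = 2 * Complex.cos (n * θ j) := by
      intro j
      rw [Complex.two_cos, ← Complex.exp_neg, ← Complex.exp_nat_mul, ← Complex.exp_nat_mul]
      congr 2 <;> ring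
    have h0 : 2 * (Δ n : ℂ) = 0 := by
      rw [show Δ n = 0 from hn]
      simp
    rw [hΔ] at h0
    simp only [Set.mem_ofPred_eq, Fintype.sum_sum_type, c, β, Sum.elim_inl, Sum.elim_inr,
      Finset.univ_unique, Finset.sum_singleton]
    rw [← h0]
    push_cast
    have hsum : ∑ j, 2 * (m j : ℂ) * z j ^ n + ∑ j, 2 * (m j : ℂ) * (z j)⁻¹ ^ n =
        2 * ∑ j, 2 * (m j : ℂ) * Complex.cos (n * θ j) := by
      rw [← Finset.sum_add_distrib, Finset.mul_sum]
      refine Finset.sum_congr rfl fun j _ => ?_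
      rw [← mul_add, hcos]
      ring
    rw [hsum, one_pow]
    ring
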